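/- arXiv:2510.23484 — 3 statements merged into one kernel-verified Lean document; each statement's English description precedes it below -/
import Mathlib

section
/- Let r > 0 and let B be the closed Euclidean ball of radius r centered at the origin in ℝ^d, with d ≥ 1. For any n = d+1 points z₁, …, zₙ ∈ B, the minimum spanning tree length satisfies E(MST({z₁,…,zₙ})) ≤ (n−1) · r · √(2(d+1)/d), i.e., every spanning tree on the indices has some spanning tree of total length at most d · r · √(2(d+1)/d), and this bound is an upper bound for the minimal spanning tree length. -/
open scoped BigOperators

/-- The length of an edge `e` (an unordered pair of indices) with respect to
points `z` in Euclidean space: the Euclidean distance between its endpoints. -/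
noncomputable def edgeLen {V : Type*} {d : ℕ} (z : V → EuclideanSpace ℝ (Fin d)) :
    Sym2 V → ℝ :=
  Sym2.lift ⟨fun i j => dist (z i) (z j), fun i j => dist_comm (z i) (z j)⟩

/-- The total edge length of a graph `G` on the (finite) index set `V`,
with respect to points `z` in Euclidean space. -/
noncomputable def treeLength {V : Type*} [Finite V] {d : ℕ}
    (z : V → EuclideanSpace ℝ (Fin d)) (G : SimpleGraph V) : ℝ :=
  ∑ e ∈ (Set.toFinite G.edgeSet).toFinset, edgeLen z e

/-- The minimum spanning tree length of the points `z`: the infimum of the total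
edge lengths of all spanning trees (connected acyclic simple graphs) on `V`. -/
noncomputable def mstLength {V : Type*} [Finite V] {d : ℕ}
    (z : V → EuclideanSpace ℝ (Fin d)) : ℝ :=
  sInf (treeLength z '' {G : SimpleGraph V | G.IsTree})

lemma edgeLen_nonneg {V : Type*} {d : ℕ} (z : V → EuclideanSpace ℝ (Fin d)) (e : Sym2 V) :
    0 ≤ edgeLen z e := by
  induction e with
  | _ i j => exact dist_nonneg (x := z i) (y := z j)

lemma treeLength_nonneg {V : Type*} [Finite V] {d : ℕ} (z : V → EuclideanSpace ℝ (Fin d))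
    (G : SimpleGraph V) : 0 ≤ treeLength z G :=
  Finset.sum_nonneg fun e _ => edgeLen_nonneg z e

lemma mstLength_le_treeLength {V : Type*} [Finite V] {d : ℕ} (z : V → EuclideanSpace ℝ (Fin d))
    {G : SimpleGraph V} (hG : G.IsTree) : mstLength z ≤ treeLength z G :=
  csInf_le ⟨0, by rintro _ ⟨H, -, rfl⟩; exact treeLength_nonneg z H⟩ ⟨G, hG, rfl⟩

lemma mstLength_nonneg {V : Type*} [Finite V] {d : ℕ} (z : V → EuclideanSpace ℝ (Fin d)) :
    0 ≤ mstLength z :=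
  Real.sInf_nonneg (by rintro _ ⟨H, -, rfl⟩; exact treeLength_nonneg z H)

lemma treeLength_starGraph {V : Type*} [Fintype V] [DecidableEq V] {d : ℕ}
    (z : V → EuclideanSpace ℝ (Fin d)) (i : V) :
    treeLength z (SimpleGraph.starGraph i) = ∑ j ∈ Finset.univ.erase i, dist (z i) (z j) := by
  have hedges : (Set.toFinite (SimpleGraph.starGraph i).edgeSet).toFinset =
      (Finset.univ.erase i).image fun j => s(i, j) := by
    ext e
    induction e with
    | _ a b =>
      simp only [Set.Finite.mem_toFinset, SimpleGraph.mem_edgeSet, SimpleGraph.starGraph_adj,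
        Finset.mem_image, Finset.mem_erase, Finset.mem_univ, and_true, Sym2.eq_iff]
      constructor
      · rintro ⟨hab, rfl | rfl⟩
        · exact ⟨b, hab.symm, .inl ⟨rfl, rfl⟩⟩
        · exact ⟨a, hab, .inr ⟨rfl, rfl⟩⟩
      · rintro ⟨c, hc, ⟨rfl, rfl⟩ | ⟨rfl, rfl⟩⟩
        · exact ⟨hc.symm, .inl rfl⟩
        · exact ⟨hc, .inr rfl⟩
  rw [treeLength, hedges, Finset.sum_image fun a _ b _ h => Sym2.congr_right.mp h]
  rfl

/-- The sum of squared distances over ordered pairs of points in a ball of radius `r`. -/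
lemma sum_dist_sq_le {V E : Type*} [Fintype V] [NormedAddCommGroup E] [InnerProductSpace ℝ E]
    {r : ℝ} {z : V → E} (hz : ∀ i, ‖z i‖ ≤ r) :
    ∑ i, ∑ j, dist (z i) (z j) ^ 2 ≤ 2 * (Fintype.card V : ℝ) ^ 2 * r ^ 2 := by
  have hsum : ∑ i, ∑ j, dist (z i) (z j) ^ 2 =
      2 * Fintype.card V * ∑ i, ‖z i‖ ^ 2 - 2 * ‖∑ i, z i‖ ^ 2 := by
    have hinner : ‖∑ i, z i‖ ^ 2 = ∑ i, ∑ j, inner ℝ (z i) (z j) := by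
      rw [← real_inner_self_eq_norm_sq, sum_inner]
      simp_rw [inner_sum]
    simp_rw [dist_eq_norm, norm_sub_sq_real, Finset.sum_add_distrib, Finset.sum_sub_distrib,
      ← Finset.mul_sum, hinner]
    simp only [Finset.sum_const, Finset.card_univ, nsmul_eq_mul, ← Finset.mul_sum]
    ring
  have hnorm : ∑ i, ‖z i‖ ^ 2 ≤ Fintype.card V * r ^ 2 := by
    calc ∑ i, ‖z i‖ ^ 2 ≤ ∑ _i : V, r ^ 2 :=
          Finset.sum_le_sum fun i _ => pow_le_pow_left₀ (norm_nonneg _) (hz i) 2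
      _ = Fintype.card V * r ^ 2 := by simp
  have hmul := mul_le_mul_of_nonneg_left hnorm (Nat.cast_nonneg (α := ℝ) (Fintype.card V))
  rw [hsum]
  nlinarith [sq_nonneg ‖∑ i, z i‖]

/-- Averaging over all stars bounds the minimum spanning tree length of `n` points in a ball. -/
lemma mstLength_sq_le {V : Type*} [Fintype V] [Nonempty V] {d : ℕ} {r : ℝ}
    {z : V → EuclideanSpace ℝ (Fin d)} (hz : ∀ i, ‖z i‖ ≤ r) :
    mstLength z ^ 2 ≤ 2 * Fintype.card V * (Fintype.card V - 1 : ℝ) * r ^ 2 := by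
  classical
  have hn : (1 : ℝ) ≤ Fintype.card V := by exact_mod_cast Fintype.card_pos (α := V)
  have hstar (i : V) : mstLength z ^ 2 ≤
      (Fintype.card V - 1 : ℝ) * ∑ j, dist (z i) (z j) ^ 2 := by
    calc mstLength z ^ 2
        ≤ (∑ j ∈ Finset.univ.erase i, dist (z i) (z j)) ^ 2 := by
          rw [← treeLength_starGraph]
          exact pow_le_pow_left₀ (mstLength_nonneg z)
            (mstLength_le_treeLength z (SimpleGraph.isTree_starGraph i)) 2
      _ ≤ ((Finset.univ.erase i).card : ℝ) *
            ∑ j ∈ Finset.univ.erase i, dist (z i) (z j) ^ 2 := sq_sum_le_card_mul_sum_sq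
      _ = (Fintype.card V - 1 : ℝ) * ∑ j, dist (z i) (z j) ^ 2 := by
          rw [Finset.sum_erase _ (by simp), Finset.card_erase_of_mem (Finset.mem_univ i),
            Finset.card_univ, Nat.cast_pred Fintype.card_pos]
  have havg : Fintype.card V * mstLength z ^ 2 ≤
      (Fintype.card V - 1 : ℝ) * ∑ i, ∑ j, dist (z i) (z j) ^ 2 := by
    calc Fintype.card V * mstLength z ^ 2 = ∑ _i : V, mstLength z ^ 2 := by simp
      _ ≤ _ := by
        rw [Finset.mul_sum]
        exact Finset.sum_le_sum fun i _ => hstar i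
  have hdist := mul_le_mul_of_nonneg_left (sum_dist_sq_le hz) (sub_nonneg.mpr hn)
  refine le_of_mul_le_mul_left ?_ (zero_lt_one.trans_le hn)
  linarith

/-- For `n = d+1` points in the closed ball of radius `r` centered at the origin
in `ℝ^d`, the MST length is at most `(n-1)·r·√(2(d+1)/d) = d·r·√(2(d+1)/d)`. -/
theorem mst_le_of_mem_ball_simplex_bound {d : ℕ} (hd : 1 ≤ d) (r : ℝ) (hr : 0 < r)
    (z : Fin (d + 1) → EuclideanSpace ℝ (Fin d))
    (hz : ∀ i, z i ∈ Metric.closedBall (0 : EuclideanSpace ℝ (Fin d)) r) :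
    mstLength z ≤ (d : ℝ) * r * Real.sqrt (2 * ((d : ℝ) + 1) / (d : ℝ)) := by
  have hd' : (0 : ℝ) < d := by exact_mod_cast hd
  have hsq := mstLength_sq_le fun i => mem_closedBall_zero_iff.mp (hz i)
  refine (sq_le_sq₀ (mstLength_nonneg z) (by positivity)).mp ?_
  rw [mul_pow, Real.sq_sqrt (by positivity)]
  refine hsq.trans_eq ?_
  rw [Fintype.card_fin]
  push_cast
  field_simp
  ring
end

section
/- (Sum of pairwise distances is maximized by the regular simplex.) Let r > 0 and let B be the closed Euclidean ball of radius r centered at the origin in ℝ^d. For any n = d+1 points z₁, …, zₙ ∈ B, the sum of pairwise distances satisfies Σ_{1 ≤ i < j ≤ n} ‖z_i − z_j‖₂ ≤ (n(n−1)/2) · r · √(2(d+1)/d); equality holds when the points lie on the bounding sphere at the vertices of a regular d-simplex (i.e., all pairwise distances equal r·√(2(d+1)/d)). -/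
open scoped BigOperators

open Finset in
/-- The sum of a symmetric function over all ordered pairs is twice the sum over the increasing
pairs plus the sum over the diagonal. -/
theorem sum_product_eq_two_mul_sum_lt_add_sum_diag {ι : Type*} [Fintype ι] [LinearOrder ι]
    (f : ι → ι → ℝ) (hf : ∀ i j, f i j = f j i) :
    ∑ i, ∑ j, f i j =
      2 * ∑ p ∈ univ.filter (fun p : ι × ι => p.1 < p.2), f p.1 p.2 + ∑ i, f i i := by
  have hlt : ∑ p ∈ univ.filter (fun p : ι × ι => p.1 < p.2), f p.1 p.2 =
      ∑ i, ∑ j, if i < j then f i j else 0 := by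
    rw [sum_filter, Fintype.sum_prod_type]
  have hgt : ∑ i, ∑ j, (if i < j then f i j else 0) =
      ∑ i, ∑ j, if j < i then f i j else 0 := by
    rw [sum_comm]
    simp only [hf]
  have hdiag : ∑ i, f i i = ∑ i, ∑ j, if i = j then f i j else 0 := by simp
  rw [two_mul, hlt]
  nth_rewrite 2 [hgt]
  rw [hdiag]
  simp only [← sum_add_distrib]
  refine sum_congr rfl fun i _ => sum_congr rfl fun j _ => ?_
  rcases lt_trichotomy i j with h | h | h
  · simp [h, h.not_gt, h.ne]
  · simp [h]
  · simp [h, h.not_gt, h.ne']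

open Finset in
theorem two_mul_card_filter_lt_add_card (ι : Type*) [Fintype ι] [LinearOrder ι] :
    2 * ((univ.filter (fun p : ι × ι => p.1 < p.2)).card : ℝ) + Fintype.card ι =
      (Fintype.card ι : ℝ) ^ 2 := by
  have h := sum_product_eq_two_mul_sum_lt_add_sum_diag (fun _ _ : ι => (1 : ℝ)) fun _ _ => rfl
  simp only [sum_const, nsmul_eq_mul, mul_one, card_univ] at h
  rw [← h, sq]

theorem sum_sum_dist_sq {ι E : Type*} [Fintype ι] [NormedAddCommGroup E] [InnerProductSpace ℝ E]
    (z : ι → E) :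
    ∑ i, ∑ j, dist (z i) (z j) ^ 2 =
      2 * Fintype.card ι * ∑ i, ‖z i‖ ^ 2 - 2 * ‖∑ i, z i‖ ^ 2 := by
  have hinner : ‖∑ i, z i‖ ^ 2 = ∑ i, ∑ j, inner ℝ (z i) (z j) := by
    rw [← real_inner_self_eq_norm_sq, sum_inner]
    simp only [inner_sum]
  simp only [hinner, dist_eq_norm, norm_sub_sq_real, Finset.sum_add_distrib,
    Finset.sum_sub_distrib, Finset.sum_const, Finset.card_univ, nsmul_eq_mul, ← Finset.mul_sum]
  ring

open Finset in
/-- For `n` points in a ball of radius `r` of an inner product space, the sum of the squared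
pairwise distances is at most `(n * r) ^ 2`. -/
theorem sum_lt_dist_sq_le {ι E : Type*} [Fintype ι] [LinearOrder ι] [NormedAddCommGroup E]
    [InnerProductSpace ℝ E] {r : ℝ} (z : ι → E) (hz : ∀ i, ‖z i‖ ≤ r) :
    ∑ p ∈ univ.filter (fun p : ι × ι => p.1 < p.2), dist (z p.1) (z p.2) ^ 2 ≤
      (Fintype.card ι * r) ^ 2 := by
  have h := sum_product_eq_two_mul_sum_lt_add_sum_diag (fun i j => dist (z i) (z j) ^ 2)
    fun i j => by rw [dist_comm]
  have hnorm : ∑ i, ‖z i‖ ^ 2 ≤ Fintype.card ι * r ^ 2 := by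
    have := sum_le_card_nsmul univ (fun i => ‖z i‖ ^ 2) (r ^ 2) fun i _ =>
      pow_le_pow_left₀ (norm_nonneg _) (hz i) 2
    simpa using this
  have hmul := mul_le_mul_of_nonneg_left hnorm (Nat.cast_nonneg (α := ℝ) (Fintype.card ι))
  simp only [sum_sum_dist_sq, dist_self, ne_eq, OfNat.ofNat_ne_zero, not_false_eq_true, zero_pow,
    sum_const_zero, add_zero] at h
  linarith [sq_nonneg ‖∑ i, z i‖]

/-- For `n = d+1` points in the closed ball of radius `r` centered at the origin in
`ℝ^d`, the sum of pairwise distances is at most `(n(n-1)/2)·r·√(2(d+1)/d)`; equality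
holds when the points lie on the bounding sphere at the vertices of a regular
`d`-simplex, i.e., when all pairwise distances equal `r·√(2(d+1)/d)`. -/
theorem sum_pairwise_dist_le_regular_simplex {d : ℕ} (hd : 1 ≤ d) (r : ℝ) (hr : 0 < r)
    (z : Fin (d + 1) → EuclideanSpace ℝ (Fin d))
    (hz : ∀ i, z i ∈ Metric.closedBall (0 : EuclideanSpace ℝ (Fin d)) r) :
    (∑ p ∈ Finset.univ.filter (fun p : Fin (d + 1) × Fin (d + 1) => p.1 < p.2),
        dist (z p.1) (z p.2)) ≤
      (((d : ℝ) + 1) * (d : ℝ) / 2) * r * Real.sqrt (2 * ((d : ℝ) + 1) / (d : ℝ)) ∧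
    ((∀ i, ‖z i‖ = r) →
      (∀ i j : Fin (d + 1), i ≠ j →
          dist (z i) (z j) = r * Real.sqrt (2 * ((d : ℝ) + 1) / (d : ℝ))) →
      (∑ p ∈ Finset.univ.filter (fun p : Fin (d + 1) × Fin (d + 1) => p.1 < p.2),
          dist (z p.1) (z p.2)) =
        (((d : ℝ) + 1) * (d : ℝ) / 2) * r * Real.sqrt (2 * ((d : ℝ) + 1) / (d : ℝ))) := by
  have hd0 : (0 : ℝ) < d := by exact_mod_cast hd
  have hcard := two_mul_card_filter_lt_add_card (Fin (d + 1))
  simp only [Fintype.card_fin, Nat.cast_add, Nat.cast_one] at hcard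
  constructor
  · have hsq := sum_lt_dist_sq_le z fun i => mem_closedBall_zero_iff.1 (hz i)
    simp only [Fintype.card_fin, Nat.cast_add, Nat.cast_one] at hsq
    refine (abs_le_of_sq_le_sq' ?_ (by positivity)).2
    refine (sq_sum_le_card_mul_sum_sq).trans
      ((mul_le_mul_of_nonneg_left hsq (Nat.cast_nonneg _)).trans_eq ?_)
    rw [mul_pow _ (Real.sqrt _), Real.sq_sqrt (by positivity)]
    field_simp
    linear_combination hcard
  · intro _ hdist
    rw [Finset.sum_congr rfl fun p hp => hdist p.1 p.2 (Finset.mem_filter.1 hp).2.ne,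
      Finset.sum_const, nsmul_eq_mul]
    linear_combination (r * Real.sqrt (2 * ((d : ℝ) + 1) / (d : ℝ)) / 2) * hcard
end

section
/- Let (K, μ) be a measure space with 0 < μ(K) < ∞, let 0 < p < 1, and let f be a probability density on K (nonnegative measurable with ∫ f dμ = 1). If ∫ f^p dμ = μ(K)^{1−p}, then f = 1/μ(K) μ-almost everywhere; i.e., the uniform density is the unique maximizer (up to a.e. equality) of f ↦ ∫ f^p dμ over probability densities on K. -/
open MeasureTheory

/-- Uniqueness of the maximizer: for a measure space `(K, μ)` with `0 < μ(K) < ∞`,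
`0 < p < 1`, and a probability density `f` on `K`, if `∫ f^p dμ = μ(K)^(1-p)` then
`f = 1/μ(K)` almost everywhere; i.e. the uniform density is the unique maximizer
(up to a.e. equality) of `f ↦ ∫ f^p dμ` over probability densities. -/
theorem ae_eq_uniform_of_integral_rpow_eq {K : Type*} [MeasurableSpace K]
    (μ : Measure K) (h0 : 0 < μ Set.univ) (htop : μ Set.univ < ⊤)
    (p : ℝ) (hp0 : 0 < p) (hp1 : p < 1)
    (f : K → ℝ) (hf : Measurable f) (hfnn : ∀ x, 0 ≤ f x)
    (hfint : ∫ x, f x ∂μ = 1)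
    (heq : (∫ x, f x ^ p ∂μ) = (μ Set.univ).toReal ^ (1 - p)) :
    ∀ᵐ x ∂μ, f x = ((μ Set.univ).toReal)⁻¹ := by
  have : IsFiniteMeasure μ := ⟨htop⟩
  set m := (μ Set.univ).toReal
  have hm0 : 0 < m := ENNReal.toReal_pos h0.ne' htop.ne
  have hreal : μ.real Set.univ = m := rfl
  have hfi : Integrable f μ := by
    by_contra h
    simp [integral_undef h] at hfint
  have hgi : Integrable (fun x => f x ^ p) μ := by
    by_contra h
    rw [integral_undef h] at heq
    exact (Real.rpow_pos_of_pos hm0 (1 - p)).ne heq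
  have havg : ⨍ x, f x ∂μ = m⁻¹ := by
    rw [average_eq, hfint, hreal, smul_eq_mul, mul_one]
  have hpavg : ⨍ x, f x ^ p ∂μ = m⁻¹ ^ p := by
    rw [average_eq, heq, hreal, smul_eq_mul, Real.rpow_sub hm0, Real.rpow_one,
      Real.inv_rpow hm0.le]
    field_simp
  rcases (Real.strictConcaveOn_rpow hp0 hp1).ae_eq_const_or_lt_map_average
      (Real.continuous_rpow_const hp0.le).continuousOn isClosed_Ici
      (Filter.Eventually.of_forall hfnn) hfi hgi with h | h
  · filter_upwards [h] with x hx
    rw [hx, Function.const_apply, havg]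
  · rw [havg, hpavg] at h
    exact absurd h (lt_irrefl _)
end
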